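/- In the deterministic one-period game with T = 1 and U^1(s,t) = 1_{s=t} = −U^2(s,t) for s,t ∈ {0,1}, there is no Nash equilibrium in pure stopping strategies of type A: there is no pair (ρ*, τ*) ∈ 𝔗^a × 𝔗^a such that Γ^1(ρ, τ*) ≤ Γ^1(ρ*, τ*) for every ρ ∈ 𝔗^a and Γ^2(ρ*, τ) ≤ Γ^2(ρ*, τ*) for every τ ∈ 𝔗^a. -/

import Mathlib

/-!
Statement 1: In the deterministic one-period game with `T = 1` and
`U¹(s,t) = 1_{s=t} = -U²(s,t)`, there is no Nash equilibrium in pure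
stopping strategies of type A.  The probability space is trivial, so stopping
times are just constants in `{0,1}`.
-/

namespace OnePeriod

/-- `φ ∈ 𝕋^a` (trivial probability space, `T = 1`): `φ(t) ∈ 𝒯_{t+}`, i.e.
`min (t+1) 1 ≤ φ t ≤ 1`, for each stage `t ∈ {0,1}`. -/
def MemTTa (φ : ℕ → ℕ) : Prop :=
  ∀ t ≤ 1, min (t + 1) 1 ≤ φ t ∧ φ t ≤ 1

/-- A pure stopping strategy of type A: `ρ = (ρ₀, ρ₁)` with `ρ₀ ∈ 𝒯` (a constant
in `{0,1}`) and `ρ₁ ∈ 𝕋^a`. -/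
def MemSA (ρ : ℕ × (ℕ → ℕ)) : Prop :=
  ρ.1 ≤ 1 ∧ MemTTa ρ.2

/-- `ζ[η] = ζ₀ 1_{ζ₀ ≤ η₀} + ζ₁(η₀) 1_{ζ₀ > η₀}`. -/
def adj (ζ η : ℕ × (ℕ → ℕ)) : ℕ :=
  if ζ.1 ≤ η.1 then ζ.1 else ζ.2 η.1

/-- `U¹(s,t) = 1_{s=t}`. -/
def U1 (s t : ℕ) : ℝ := if s = t then 1 else 0

/-- `U²(s,t) = -1_{s=t}`. -/
def U2 (s t : ℕ) : ℝ := -(U1 s t)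

/-- `Γ(ζ,η) = U(ζ[η], η[ζ])` (no expectation needed: the space is trivial). -/
def Gam (U : ℕ → ℕ → ℝ) (ζ η : ℕ × (ℕ → ℕ)) : ℝ :=
  U (adj ζ η) (adj η ζ)

theorem adj_eq (ζ η : ℕ × (ℕ → ℕ)) (hζ : MemSA ζ) : adj ζ η = ζ.1 := by
  obtain ⟨h1, h2⟩ := hζ
  unfold adj
  split_ifs with h
  · rfl
  · have h0 : η.1 = 0 := by omega
    have := h2 0 (by omega)
    rw [h0]
    omega

theorem memSA_const (n : ℕ) (hn : n ≤ 1) : MemSA (n, fun _ => 1) :=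
  ⟨hn, fun t _ => ⟨by simp, le_refl 1⟩⟩

/-- There is no Nash equilibrium in pure stopping strategies of type A for the
deterministic one-period game `u¹ = 1_{s=t} = -u²`. -/
theorem no_pure_nash_equilibrium :
    ¬ ∃ ρs τs : ℕ × (ℕ → ℕ), MemSA ρs ∧ MemSA τs ∧
      (∀ ρ : ℕ × (ℕ → ℕ), MemSA ρ → Gam U1 ρ τs ≤ Gam U1 ρs τs) ∧
      (∀ τ : ℕ × (ℕ → ℕ), MemSA τ → Gam U2 ρs τ ≤ Gam U2 ρs τs) := by
  rintro ⟨ρs, τs, hρ, hτ, h1, h2⟩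
  have m1 := memSA_const τs.1 hτ.1
  have m2 := memSA_const (1 - ρs.1) (by omega)
  have a := h1 _ m1
  have b := h2 _ m2
  have hne : ρs.1 ≠ 1 - ρs.1 := by omega
  simp only [Gam, U2, U1, adj_eq _ _ m1, adj_eq _ _ m2, adj_eq _ _ hρ, adj_eq _ _ hτ] at a b
  rw [if_neg hne] at b
  rw [if_pos trivial] at a
  linarith

end OnePeriod
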